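/- Let G be a countable discrete group and c : G → ℓ²G a 1-cocycle for the left regular representation. Then K = {g ∈ G : c(g) = 0} is a subgroup of G, and for any g ∈ G such that gKg⁻¹ ∩ K is infinite, one has c(g) = 0, i.e., g ∈ K. (The key identity is that c(g) = k·c(g) for every k ∈ gKg⁻¹ ∩ K.) -/

import Mathlib

open scoped ENNReal

/-- The left regular representation of a group `G` on `ℓ²G = lp (fun _ : G => ℂ) 2`:
`(lreg g f) h = f (g⁻¹ * h)`. -/
noncomputable def lreg {G : Type*} [Group G] (g : G) (f : lp (fun _ : G => ℂ) 2) :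
    lp (fun _ : G => ℂ) 2 :=
  ⟨fun h => f (g⁻¹ * h), by
    show Memℓp (fun h : G => f (g⁻¹ * h)) 2
    rw [memℓp_gen_iff (by norm_num)]
    have hf : Summable fun h : G => ‖f h‖ ^ (2 : ℝ≥0∞).toReal :=
      (memℓp_gen_iff (by norm_num)).1 (lp.memℓp f)
    exact ((Equiv.mulLeft g⁻¹).summable_iff
      (f := fun h : G => ‖f h‖ ^ (2 : ℝ≥0∞).toReal)).2 hf⟩

theorem lreg_apply {G : Type*} [Group G] (g : G) (f : lp (fun _ : G => ℂ) 2) (h : G) :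
    lreg g f h = f (g⁻¹ * h) := rfl

theorem lreg_one {G : Type*} [Group G] (f : lp (fun _ : G => ℂ) 2) : lreg 1 f = f := by
  ext h
  simp [lreg_apply]

theorem lreg_zero {G : Type*} [Group G] (g : G) :
    lreg g (0 : lp (fun _ : G => ℂ) 2) = 0 := by
  ext h
  simp [lreg_apply]

/-- A square-summable function fixed by infinitely many translations vanishes. -/
theorem eq_zero_of_infinite_lreg_fixed {G : Type*} [Group G] (f : lp (fun _ : G => ℂ) 2)
    (hf : {k : G | f = lreg k f}.Infinite) : f = 0 := by
  ext h
  by_contra hne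
  have hsum : Summable fun x : G => ‖f x‖ ^ (2 : ℝ≥0∞).toReal :=
    (memℓp_gen_iff (by norm_num)).1 (lp.memℓp f)
  have hpos : 0 < ‖f h‖ ^ (2 : ℝ≥0∞).toReal := Real.rpow_pos_of_pos (norm_pos_iff.2 hne) _
  have hfin := Filter.eventually_cofinite.1
    (hsum.tendsto_cofinite_zero.eventually (gt_mem_nhds hpos))
  have hinj : Function.Injective fun k : G => k⁻¹ * h := fun a b hab => by simpa using hab
  refine (hf.image hinj.injOn) (hfin.subset ?_)
  rintro _ ⟨k, hk, rfl⟩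
  have hkh : f h = f (k⁻¹ * h) := by
    rw [← lreg_apply, ← show f = lreg k f from hk]
  simp [← hkh]

/-- For a `1`-cocycle `c : G → ℓ²G`, the set `K = {g : c g = 0}` is a subgroup;
one has `c g = k • (c g)` for every `k ∈ gKg⁻¹ ∩ K`, and if `gKg⁻¹ ∩ K` is
infinite then `c g = 0`, i.e. `g ∈ K`. -/
theorem kernel_of_cocycle {G : Type*} [Group G] [Countable G]
    (c : G → lp (fun _ : G => ℂ) 2)
    (hc : ∀ g h : G, c (g * h) = lreg g (c h) + c g) :
    ∃ K : Subgroup G, (K : Set G) = {g : G | c g = 0} ∧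
      (∀ g k : G, k ∈ K → g⁻¹ * k * g ∈ K → c g = lreg k (c g)) ∧
      ∀ g : G, {k : G | k ∈ K ∧ g⁻¹ * k * g ∈ K}.Infinite → c g = 0 := by
  have h_one : c 1 = 0 := by simpa [lreg_one] using hc 1 1
  have h_fixed (g k : G) (hk : c k = 0) (hk' : c (g⁻¹ * k * g) = 0) : c g = lreg k (c g) := by
    have h_left := hc k g
    have h_right := hc g (g⁻¹ * k * g)
    rw [hk, add_zero] at h_left
    rw [hk', lreg_zero, zero_add, show g * (g⁻¹ * k * g) = k * g by group] at h_right
    exact h_right.symm.trans h_left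
  refine ⟨{ carrier := {g | c g = 0}, one_mem' := h_one, mul_mem' := ?_, inv_mem' := ?_ },
    rfl, h_fixed, fun g hg => ?_⟩
  · intro a b (ha : c a = 0) (hb : c b = 0)
    simp [hc, ha, hb, lreg_zero]
  · intro a (ha : c a = 0)
    simpa [h_one, ha, lreg_zero] using (hc a⁻¹ a).symm
  · exact eq_zero_of_infinite_lreg_fixed _ (hg.mono fun k hk => h_fixed g k hk.1 hk.2)
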